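/- arXiv:2303.00103 — 2 statements merged into one kernel-verified Lean document; each statement's English description precedes it below -/
import Mathlib

section
/- Let α ∈ ℂ and let a := (4/3)·π·i·ω·(a₁ + ω·a₂) with a₁, a₂ ∈ ℤ. For every real-differentiable function u = (u₁, u₂) : ℂ → ℂ², the twisted translation ℒ_a, defined by (ℒ_a u)(z) := (ω^{a₁+a₂}·u₁(z + a), u₂(z + a)), commutes with the chiral TBG operator D(α): for every z ∈ ℂ, (D(α)(ℒ_a u))(z) = (ℒ_a (D(α) u))(z). -/
/-- `ω = exp(2πi/3)`. -/
noncomputable def ω : ℂ := Complex.exp (2 * Real.pi * Complex.I / 3)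

/-- The tunneling potential `U(z) = Σ_{k=0}^{2} ω^k exp((z ω̄^k − z̄ ω^k)/2)`. -/
noncomputable def U (z : ℂ) : ℂ :=
  ∑ k ∈ Finset.range 3,
    ω ^ k * Complex.exp ((z * (starRingEnd ℂ ω) ^ k - (starRingEnd ℂ z) * ω ^ k) / 2)

/-- `(2 D_{z̄} f)(z) = −i (∂₁ f(z) + i ∂₂ f(z))`, the directional derivatives taken
along `1` and `i` in the real sense. -/
noncomputable def Dzbar (f : ℂ → ℂ) (z : ℂ) : ℂ :=
  -Complex.I * (fderiv ℝ f z 1 + Complex.I * fderiv ℝ f z Complex.I)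

/-- The chiral TBG operator `D(α)` acting on `u = (u₁, u₂) : ℂ → ℂ²`. -/
noncomputable def Dop (α : ℂ) (u : ℂ → ℂ × ℂ) (z : ℂ) : ℂ × ℂ :=
  (Dzbar (fun w => (u w).1) z + α * U z * (u z).2,
   α * U (-z) * (u z).1 + Dzbar (fun w => (u w).2) z)

/-- The lattice vector `a = (4/3)πiω(a₁ + ω a₂)`. -/
noncomputable def latVec (a₁ a₂ : ℤ) : ℂ :=
  (4 / 3) * (Real.pi : ℂ) * Complex.I * ω * ((a₁ : ℂ) + ω * (a₂ : ℂ))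

/-- The twisted translation `(ℒ_a u)(z) = (ω^{a₁+a₂} u₁(z+a), u₂(z+a))`. -/
noncomputable def Ltrans (a₁ a₂ : ℤ) (u : ℂ → ℂ × ℂ) (z : ℂ) : ℂ × ℂ :=
  (ω ^ (a₁ + a₂) * (u (z + latVec a₁ a₂)).1, (u (z + latVec a₁ a₂)).2)

theorem om_prim : IsPrimitiveRoot ω 3 := by
  have h := Complex.isPrimitiveRoot_exp 3 (by norm_num)
  unfold ω
  simpa using h

theorem om_ne : ω ≠ 0 := Complex.exp_ne_zero _

theorem om_sum : ω ^ 2 = -1 - ω := by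
  have h3 := om_prim.pow_eq_one
  have h1 : ω - 1 ≠ 0 := sub_ne_zero.mpr (om_prim.ne_one (by norm_num))
  have : (ω - 1) * (ω ^ 2 + ω + 1) = 0 := by linear_combination h3
  rcases mul_eq_zero.mp this with h | h
  · exact absurd h h1
  · linear_combination h

theorem om_conj : (starRingEnd ℂ) ω = -1 - ω := by
  have h3 := om_prim.pow_eq_one
  have h : (starRingEnd ℂ) ω * ω = 1 := by
    unfold ω
    rw [← Complex.exp_conj, ← Complex.exp_add]
    rw [Complex.exp_eq_one_iff]
    refine ⟨0, ?_⟩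
    simp only [map_mul, map_div₀, map_ofNat, Complex.conj_I, Complex.conj_ofReal]
    push_cast
    ring
  rw [← om_sum]
  linear_combination ω ^ 2 * h - (starRingEnd ℂ) ω * h3

theorem om_zpow (s : ℤ) : ω ^ s = Complex.exp (s * (2 * Real.pi * Complex.I / 3)) := by
  unfold ω
  rw [← Complex.exp_int_mul]

theorem exp_aux (s n : ℤ) (x y : ℂ)
    (h : y = x - s * (2 * Real.pi * Complex.I / 3) + n * (2 * Real.pi * Complex.I)) :
    ω ^ s * Complex.exp y = Complex.exp x := by
  rw [om_zpow, ← Complex.exp_add, h, Complex.exp_eq_exp_iff_exists_int]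
  exact ⟨n, by ring⟩

theorem latVec_conj (a₁ a₂ : ℤ) : (starRingEnd ℂ) (latVec a₁ a₂) =
    -((4 / 3) * (Real.pi : ℂ) * Complex.I * (-1 - ω) * ((a₁ : ℂ) + (-1 - ω) * (a₂ : ℂ))) := by
  unfold latVec
  simp only [map_mul, map_add, om_conj, Complex.conj_I, Complex.conj_ofReal, map_intCast,
    map_div₀, map_ofNat]
  ring

theorem U_shift (a₁ a₂ : ℤ) (z : ℂ) : ω ^ (a₁ + a₂) * U (z + latVec a₁ a₂) = U z := by
  have h2 := om_sum
  unfold U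
  rw [Finset.mul_sum]
  simp only [Finset.sum_range_succ, Finset.sum_range_zero, map_add, latVec_conj, om_conj]
  have key : ∀ (k : ℕ) (n : ℤ) (x y : ℂ),
      y = x - (a₁ + a₂ : ℤ) * (2 * Real.pi * Complex.I / 3) + n * (2 * Real.pi * Complex.I) →
      ω ^ (a₁ + a₂) * (ω ^ k * Complex.exp y) = ω ^ k * Complex.exp x := by
    intro k n x y h
    rw [← exp_aux (a₁ + a₂) n x y h]; ring
  have h3 : ω ^ 3 = 1 := om_prim.pow_eq_one
  have h4 : ω ^ 4 = ω := by linear_combination ω * h3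
  unfold latVec
  congr 1
  · congr 1
    · congr 1
      refine key 0 0 _ _ ?_
      push_cast
      ring_nf
      simp only [h2, h3, h4]
      ring
    · refine key 1 a₁ _ _ ?_
      push_cast
      ring_nf
      simp only [h2, h3, h4]
      ring
  · refine key 2 a₂ _ _ ?_
    push_cast
    ring_nf
    simp only [h2, h3, h4]
    ring

theorem Dzbar_shift (f : ℂ → ℂ) (hf : Differentiable ℝ f) (c a z : ℂ) :
    Dzbar (fun w => c * f (w + a)) z = c * Dzbar f (z + a) := by
  unfold Dzbar
  have h : fderiv ℝ (fun w => c * f (w + a)) z = c • fderiv ℝ f (z + a) := by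
    rw [fderiv_const_mul (by fun_prop), fderiv_comp_add_right]
  rw [h]
  simp only [ContinuousLinearMap.smul_apply, smul_eq_mul]
  ring

/-- The twisted translations `ℒ_a` commute with the chiral operator `D(α)`. -/
theorem Dop_comm_Ltrans (α : ℂ) (a₁ a₂ : ℤ) (u : ℂ → ℂ × ℂ)
    (hu : Differentiable ℝ u) (z : ℂ) :
    Dop α (Ltrans a₁ a₂ u) z = Ltrans a₁ a₂ (fun w => Dop α u w) z := by
  have hA := U_shift a₁ a₂ z
  have hB := U_shift a₁ a₂ (-(z + latVec a₁ a₂))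
  rw [show -(z + latVec a₁ a₂) + latVec a₁ a₂ = -z by ring] at hB
  have d1 := Dzbar_shift (fun w => (u w).1) (by fun_prop) (ω ^ (a₁ + a₂)) (latVec a₁ a₂) z
  have d2 := Dzbar_shift (fun w => (u w).2) (by fun_prop) 1 (latVec a₁ a₂) z
  simp only [one_mul] at d2
  unfold Dop Ltrans
  simp only [d1, d2, Prod.mk.injEq]
  constructor
  · rw [← hA]; ring
  · rw [← hB]; ring
end

section
/- Let ω := exp(2πi/3), let k ∈ ℂ, set 𝐤 := √3·ω·k, and define F_𝐤(z) := F_k(3z/(4πiω)) where F_k(ζ) := exp(2π·(ζ − conj(ζ))·k/√3) · θ(ζ + k)/θ(ζ). Then for every z ∈ ℂ with θ(3z/(4πiω)) ≠ 0, the function F_𝐤 is real-differentiable at z and satisfies (2D_{z̄}F_𝐤)(z) + 𝐤·F_𝐤(z) = 0, where (2D_{z̄}f)(z) := −i·(∂₁f(z) + i·∂₂f(z)) and ∂₁, ∂₂ denote the directional derivatives along 1 and i. -/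
/-- The odd Jacobi theta function with modular parameter `ω`. -/
noncomputable def θf (ζ : ℂ) : ℂ :=
  -∑' n : ℤ, Complex.exp ((Real.pi : ℂ) * Complex.I * ((n : ℂ) + 1 / 2) ^ 2 * ω
      + 2 * (Real.pi : ℂ) * Complex.I * ((n : ℂ) + 1 / 2) * (ζ + 1 / 2))

/-- `F_k(ζ) = exp(2π(ζ − ζ̄)k/√3) · θ(ζ + k)/θ(ζ)`. -/
noncomputable def Ff (k ζ : ℂ) : ℂ :=
  Complex.exp (2 * (Real.pi : ℂ) * (ζ - starRingEnd ℂ ζ) * k / (Real.sqrt 3 : ℂ))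
    * θf (ζ + k) / θf ζ

/-- `F_𝐤(z) = F_k(3z/(4πiω))`, the transplant to the moiré lattice,
with `𝐤 = √3 ω k`. -/
noncomputable def FK (k z : ℂ) : ℂ :=
  Ff k (3 * z / (4 * (Real.pi : ℂ) * Complex.I * ω))

theorem aux_om_im : 0 < ω.im := by
  have h : ω = Complex.exp (((2 * Real.pi / 3 : ℝ) : ℂ) * Complex.I) := by
    unfold ω; congr 1; push_cast; ring
  rw [h, Complex.exp_ofReal_mul_I_im]
  apply Real.sin_pos_of_pos_of_lt_pi <;> linarith [Real.pi_pos]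

theorem aux_om_conj : ω * starRingEnd ℂ ω = 1 := by
  unfold ω
  rw [← Complex.exp_conj, ← Complex.exp_add, ← Complex.exp_zero]
  congr 1
  simp only [map_div₀, map_mul, Complex.conj_I, Complex.conj_ofReal, map_ofNat]
  ring

theorem aux_theta (ζ : ℂ) : θf ζ = -(Complex.exp (Real.pi * Complex.I * ω / 4
    + Real.pi * Complex.I * (ζ + 1 / 2)) * jacobiTheta₂ (ζ + 1 / 2 + ω / 2) ω) := by
  unfold θf jacobiTheta₂
  rw [← tsum_mul_left]
  congr 2
  ext n
  rw [jacobiTheta₂_term, ← Complex.exp_add]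
  congr 1
  ring

theorem aux_theta_diff : Differentiable ℂ θf := by
  have h : θf = fun ζ => -(Complex.exp (Real.pi * Complex.I * ω / 4
    + Real.pi * Complex.I * (ζ + 1 / 2)) * jacobiTheta₂ (ζ + 1 / 2 + ω / 2) ω) :=
    funext aux_theta
  rw [h]
  intro ζ
  have h1 : DifferentiableAt ℂ (fun ζ : ℂ => jacobiTheta₂ (ζ + 1 / 2 + ω / 2) ω) ζ :=
    DifferentiableAt.comp (g := fun x => jacobiTheta₂ x ω) ζ
      (differentiableAt_jacobiTheta₂_fst _ aux_om_im) (by fun_prop)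
  fun_prop

theorem aux_dbar (G : ℂ → ℂ) (a b z : ℂ) (hG : DifferentiableAt ℂ G z) :
    DifferentiableAt ℝ (fun z => Complex.exp (a * z + b * starRingEnd ℂ z) * G z) z ∧
    Dzbar (fun z => Complex.exp (a * z + b * starRingEnd ℂ z) * G z) z
      = -2 * Complex.I * b * (Complex.exp (a * z + b * starRingEnd ℂ z) * G z) := by
  have h1 := hG.hasDerivAt.hasFDerivAt.restrictScalars ℝ
  have h2 : HasFDerivAt (fun z : ℂ => starRingEnd ℂ z) (Complex.conjCLE : ℂ →L[ℝ] ℂ) z :=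
    Complex.conjCLE.hasFDerivAt
  have h3 := (((hasFDerivAt_id (𝕜 := ℝ) z).const_mul a).add (h2.const_mul b)).cexp.mul h1
  refine ⟨h3.differentiableAt, ?_⟩
  unfold Dzbar
  erw [h3.fderiv]
  simp
  linear_combination (Complex.I * a * Complex.exp (a * z + b * starRingEnd ℂ z) * G z
    - Complex.I * b * Complex.exp (a * z + b * starRingEnd ℂ z) * G z
    + Complex.I * Complex.exp (a * z + b * starRingEnd ℂ z) * deriv G z) * Complex.I_sq

/-- Away from the pole lattice, `F_𝐤` is real-differentiable and solves
`(2D_{z̄} + 𝐤)F_𝐤 = 0` with `𝐤 = √3 ω k`. -/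
theorem FK_solves_dbar (k z : ℂ)
    (hz : θf (3 * z / (4 * (Real.pi : ℂ) * Complex.I * ω)) ≠ 0) :
    DifferentiableAt ℝ (FK k) z ∧
      Dzbar (FK k) z + ((Real.sqrt 3 : ℂ) * ω * k) * FK k z = 0 := by
  have hω : ω ≠ 0 := Complex.exp_ne_zero _
  have hpi : (Real.pi : ℂ) ≠ 0 := by exact_mod_cast Real.pi_ne_zero
  have hs : (Real.sqrt 3 : ℂ) ≠ 0 := by
    exact_mod_cast (Real.sqrt_pos.2 (by norm_num : (0 : ℝ) < 3)).ne'
  have hs2 : (Real.sqrt 3 : ℂ) ^ 2 = 3 := by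
    exact_mod_cast Real.sq_sqrt (by norm_num : (0 : ℝ) ≤ 3)
  have hc : starRingEnd ℂ ω = ω⁻¹ := eq_inv_of_mul_eq_one_right aux_om_conj
  set c : ℂ := 3 / (4 * (Real.pi : ℂ) * Complex.I * ω) with hcdef
  have hI := Complex.I_ne_zero
  have hcc : starRingEnd ℂ c = 3 * Complex.I * ω / (4 * Real.pi) := by
    rw [hcdef]
    simp only [map_div₀, map_mul, Complex.conj_I, Complex.conj_ofReal, hc, map_ofNat]
    field_simp
    linear_combination (-1 : ℂ) * Complex.I_sq
  have hcz : ∀ z : ℂ, 3 * z / (4 * (Real.pi : ℂ) * Complex.I * ω) = c * z := by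
    intro z; rw [hcdef]; ring
  rw [hcz] at hz
  have hF : FK k = fun z => Complex.exp ((2 * Real.pi * c * k / Real.sqrt 3) * z
      + (-(Real.sqrt 3 * Complex.I * ω * k / 2)) * starRingEnd ℂ z)
      * (θf (c * z + k) / θf (c * z)) := by
    ext z
    unfold FK Ff
    rw [hcz, mul_div_assoc]
    congr 2
    rw [map_mul, hcc]
    field_simp
    linear_combination (4 * k * Complex.I * ω * starRingEnd ℂ z) * hs2
  have hG : DifferentiableAt ℂ (fun z => θf (c * z + k) / θf (c * z)) z := by
    have e1 : DifferentiableAt ℂ (fun z => θf (c * z + k)) z :=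
      DifferentiableAt.comp (g := θf) z (aux_theta_diff _) (by fun_prop)
    have e2 : DifferentiableAt ℂ (fun z => θf (c * z)) z :=
      DifferentiableAt.comp (g := θf) z (aux_theta_diff _) (by fun_prop)
    exact e1.div e2 hz
  obtain ⟨h1, h2⟩ := aux_dbar _ (2 * Real.pi * c * k / Real.sqrt 3)
    (-(Real.sqrt 3 * Complex.I * ω * k / 2)) z hG
  rw [hF]
  refine ⟨h1, ?_⟩
  rw [h2]
  beta_reduce
  generalize Complex.exp _ * _ = X
  linear_combination (Real.sqrt 3 * ω * k * X) * Complex.I_sq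
end
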